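/- Let G be a graph, M a maximum 2-matching of G, and v a vertex with deg_M(v) ≤ 1. Let Q be the set of vertices reachable from v by an M-alternating path of even length (including v itself). Then every vertex of N(Q) \ Q is joined to some vertex of Q by an edge of M; consequently |N(Q)| ≤ 2|Q|. -/

import Mathlib

/-- The degree of `v` in an edge set `M`. -/
noncomputable def degIn {V : Type*} (M : Set (Sym2 V)) (v : V) : ℕ :=
  {e ∈ M | v ∈ e}.ncard

open SimpleGraph

/-- The edges of `l` lie alternately outside and inside `M`, starting outside. -/
def IsAlternating {V : Type*} (M : Set (Sym2 V)) (l : List (Sym2 V)) : Prop :=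
  ∀ (j : ℕ) (h : j < l.length), (Even j → l.get ⟨j, h⟩ ∉ M) ∧ (Odd j → l.get ⟨j, h⟩ ∈ M)

theorem IsAlternating.of_append {V : Type*} {M : Set (Sym2 V)} {l l' : List (Sym2 V)}
    (h : IsAlternating M (l ++ l')) : IsAlternating M l := by
  intro j hj
  have := h j (by simp; omega)
  simpa [List.getElem_append_left hj] using this

theorem IsAlternating.append_singleton {V : Type*} {M : Set (Sym2 V)} {l : List (Sym2 V)}
    {e : Sym2 V} (h : IsAlternating M l) (he : Even l.length → e ∉ M)
    (ho : Odd l.length → e ∈ M) : IsAlternating M (l ++ [e]) := by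
  intro j hj
  rcases Nat.lt_or_ge j l.length with hlt | hge
  · simpa [List.getElem_append_left hlt] using h j hlt
  · obtain rfl : j = l.length := by simp at hj; omega
    simpa using ⟨he, ho⟩

/-- Exchanging the first two edges of an alternating list keeps its tail alternating. -/
theorem IsAlternating.tail_exchange {V : Type*} {M : Set (Sym2 V)} {e f : Sym2 V}
    {l : List (Sym2 V)} (h : IsAlternating M (e :: f :: l)) (he : e ∉ l) (hf : f ∉ l) :
    IsAlternating (insert e (M \ {f})) l := by
  intro j hj
  have := h (j + 2) (by simp; omega)
  have hmem : l[j] ∈ l := List.getElem_mem hj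
  have h1 : l[j] ≠ e := fun h => he (h ▸ hmem)
  have h2 : l[j] ≠ f := fun h => hf (h ▸ hmem)
  simpa [Nat.even_add, Nat.odd_add, h1, h2] using this

section Degree

variable {V : Type*} {M : Set (Sym2 V)} {e : Sym2 V} {x : V}

theorem degIn_insert_le : degIn (insert e M) x ≤ degIn M x + 1 := by
  unfold degIn
  by_cases hx : x ∈ e
  · rw [show {f ∈ insert e M | x ∈ f} = insert e {f ∈ M | x ∈ f} by ext f; simp; grind]
    exact Set.ncard_insert_le _ _
  · rw [show {f ∈ insert e M | x ∈ f} = {f ∈ M | x ∈ f} by ext f; simp; grind]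
    omega

theorem degIn_insert_of_notMem (hx : x ∉ e) : degIn (insert e M) x = degIn M x := by
  unfold degIn
  congr 1
  ext f
  simp
  grind

theorem degIn_diff_le [Finite V] : degIn (M \ {e}) x ≤ degIn M x :=
  Set.ncard_le_ncard (fun _ hf => ⟨hf.1.1, hf.2⟩) (Set.toFinite _)

theorem degIn_diff_of_mem [Finite V] (he : e ∈ M) (hx : x ∈ e) :
    degIn (M \ {e}) x + 1 = degIn M x := by
  unfold degIn
  rw [show {f ∈ M \ {e} | x ∈ f} = {f ∈ M | x ∈ f} \ {e} by ext f; simp; grind]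
  exact Set.ncard_sdiff_singleton_add_one (show e ∈ {f ∈ M | x ∈ f} from ⟨he, hx⟩)

end Degree

/-- An alternating path of odd length between unsaturated vertices augments a 2-matching. -/
theorem exists_larger_of_augmenting_path {V : Type*} [Finite V] {G : SimpleGraph V} {z : V} :
    ∀ {v : V} (p : G.Walk v z) (M : Set (Sym2 V)), M ⊆ G.edgeSet → (∀ x, degIn M x ≤ 2) →
      p.IsPath → Odd p.length → IsAlternating M p.edges → degIn M v ≤ 1 → degIn M z ≤ 1 →
      ∃ M' : Set (Sym2 V), M' ⊆ G.edgeSet ∧ (∀ x, degIn M' x ≤ 2) ∧ M.ncard < M'.ncard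
  | _, .nil, _, _, _, _, hodd, _, _, _ => by simp at hodd
  | v, .cons h .nil, M, hM, hdeg, _, _, halt, hv, hz => by
    have hnot : s(v, z) ∉ M := by simpa using (halt 0 (by simp)).1 (by simp)
    refine ⟨insert s(v, z) M, Set.insert_subset h hM, fun x => ?_, ?_⟩
    · by_cases hx : x ∈ s(v, z)
      · refine degIn_insert_le.trans ?_
        rcases Sym2.mem_iff.1 hx with rfl | rfl <;> omega
      · exact (degIn_insert_of_notMem hx).trans_le (hdeg x)
    · rw [Set.ncard_insert_of_notMem hnot (Set.toFinite _)]
      omega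
  | v, .cons (v := a) h (.cons (v := b) h' q), M, hM, hdeg, hp, hodd, halt, hv, hz => by
    have hnot : s(v, a) ∉ M := by simpa using (halt 0 (by simp)).1 (by simp)
    have hmem : s(a, b) ∈ M := by simpa using (halt 1 (by simp)).2 (by simp)
    have hnd := hp.isTrail.edges_nodup
    simp only [Walk.edges_cons, List.nodup_cons, List.mem_cons, not_or] at hnd
    rw [Walk.cons_isPath_iff, Walk.cons_isPath_iff] at hp
    obtain ⟨⟨hq, haq⟩, hvq⟩ := hp
    simp only [Walk.support_cons, List.mem_cons, not_or] at hvq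
    have hva : v ≠ a := h.ne
    have hab : a ≠ b := h'.ne
    have hvb : v ≠ b := fun hvb => hvq.2 (hvb ▸ q.start_mem_support)
    have hza : z ≠ a := fun hza => haq (hza ▸ q.end_mem_support)
    have hzv : z ≠ v := fun hzv => hvq.2 (hzv ▸ q.end_mem_support)
    have key : ∀ x, x ≠ v → degIn (insert s(v, a) (M \ {s(a, b)})) x ≤ degIn M x := by
      intro x hxv
      by_cases hxa : x = a
      · subst hxa
        rw [← degIn_diff_of_mem hmem (Sym2.mem_mk_left _ _)]
        exact degIn_insert_le
      · rw [degIn_insert_of_notMem (by simp [hxv, hxa])]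
        exact degIn_diff_le
    have hcard : (insert s(v, a) (M \ {s(a, b)})).ncard = M.ncard := by
      rw [Set.ncard_insert_of_notMem (fun h => hnot h.1) (Set.toFinite _),
        Set.ncard_sdiff_singleton_add_one hmem (Set.toFinite _)]
    rw [← hcard]
    refine exists_larger_of_augmenting_path q _
      (Set.insert_subset h (Set.sdiff_subset.trans hM)) (fun x => ?_) hq ?_
      (IsAlternating.tail_exchange (by simpa using halt) hnd.1.2 hnd.2.1) ?_
      ((key z hzv).trans hz)
    · by_cases hxv : x = v
      · subst hxv
        exact degIn_insert_le.trans (Nat.succ_le_succ (degIn_diff_le.trans hv))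
      · exact (key x hxv).trans (hdeg x)
    · simpa [Nat.odd_add, Nat.even_add, parity_simps] using hodd
    · rw [degIn_insert_of_notMem (by simp [hvb.symm, hab.symm])]
      have := degIn_diff_of_mem hmem (Sym2.mem_mk_right a b)
      have := hdeg b
      omega

/-- The vertices reachable from `v` by an `M`-alternating path of even length. -/
def evenReach {V : Type*} (G : SimpleGraph V) (M : Set (Sym2 V)) (v : V) : Set V :=
  {u | ∃ p : G.Walk v u, p.IsPath ∧ Even p.length ∧ IsAlternating M p.edges}

section EvenReach

variable {V : Type*} {G : SimpleGraph V} {M : Set (Sym2 V)} {v : V}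

/-- An odd alternating path extends along an `M`-edge to a new vertex. -/
theorem mem_evenReach_of_odd {w y : V} {p : G.Walk v w} (hp : p.IsPath) (hodd : Odd p.length)
    (halt : IsAlternating M p.edges) (h : G.Adj w y) (hM : s(w, y) ∈ M) (hy : y ∉ p.support) :
    y ∈ evenReach G M v := by
  refine ⟨p.concat h, hp.concat hy h, ?_, ?_⟩
  · rw [Walk.length_concat]
    exact hodd.add_one
  · rw [Walk.edges_concat, List.concat_eq_append]
    refine halt.append_singleton (fun he => ?_) (fun _ => hM)
    rw [Walk.length_edges] at he
    exact absurd he (Nat.not_even_iff_odd.2 hodd)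

theorem isAlternating_takeUntil [DecidableEq V] {u w : V} {p : G.Walk v u}
    (halt : IsAlternating M p.edges) (hw : w ∈ p.support) :
    IsAlternating M (p.takeUntil w hw).edges := by
  rw [← p.take_spec hw, Walk.edges_append] at halt
  exact halt.of_append

/-- A vertex on an even alternating path is reached evenly or joined by `M` to such a vertex. -/
theorem mem_evenReach_or_exists_of_mem_support {u z : V} {p : G.Walk v u}
    (hp : p.IsPath) (heven : Even p.length) (halt : IsAlternating M p.edges)
    (hz : z ∈ p.support) : z ∈ evenReach G M v ∨ ∃ y ∈ evenReach G M v, s(y, z) ∈ M := by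
  classical
  rcases Nat.even_or_odd (p.takeUntil z hz).length with he | hodd
  · exact .inl ⟨_, hp.takeUntil hz, he, isAlternating_takeUntil halt hz⟩
  right
  obtain ⟨q, r, rfl, ho⟩ : ∃ (q : G.Walk v z) (r : G.Walk z u), p = q.append r ∧ Odd q.length :=
    ⟨_, _, (p.take_spec hz).symm, hodd⟩
  clear hodd
  cases r with
  | nil => exact absurd (by simpa using heven) (Nat.not_even_iff_odd.2 ho)
  | @cons _ y _ h r =>
    rw [Walk.edges_append] at halt
    have hmem : s(z, y) ∈ M := by
      simpa using (halt q.edges.length (by simp)).2 (by simpa using ho)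
    rw [← Walk.concat_append] at hp
    obtain ⟨hq, hy⟩ := (Walk.concat_isPath_iff h).1 hp.of_append_left
    exact ⟨y, mem_evenReach_of_odd hq ho halt.of_append h hmem hy, Sym2.eq_swap ▸ hmem⟩

/-- For a maximum 2-matching, external neighbors of `evenReach` are joined to it by `M`. -/
theorem exists_mem_evenReach_of_adj [Finite V] (hM : M ⊆ G.edgeSet) (hdeg : ∀ x, degIn M x ≤ 2)
    (hmax : ∀ M' : Set (Sym2 V), M' ⊆ G.edgeSet → (∀ x, degIn M' x ≤ 2) → M'.ncard ≤ M.ncard)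
    (hv : degIn M v ≤ 1) {u z : V} (hz : z ∉ evenReach G M v) (hu : u ∈ evenReach G M v)
    (huz : G.Adj u z) : ∃ y ∈ evenReach G M v, s(y, z) ∈ M := by
  classical
  by_cases huzM : s(u, z) ∈ M
  · exact ⟨u, hu, huzM⟩
  obtain ⟨p, hp, heven, halt⟩ := hu
  by_cases hzp : z ∈ p.support
  · exact (mem_evenReach_or_exists_of_mem_support hp heven halt hzp).resolve_left hz
  have hp' : (p.concat huz).IsPath := hp.concat hzp huz
  have hodd' : Odd (p.concat huz).length := by
    rw [Walk.length_concat]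
    exact heven.add_one
  have halt' : IsAlternating M (p.concat huz).edges := by
    rw [Walk.edges_concat, List.concat_eq_append]
    refine halt.append_singleton (fun _ => huzM) (fun ho => ?_)
    rw [Walk.length_edges] at ho
    exact absurd heven (Nat.not_even_iff_odd.2 ho)
  have hz1 : degIn M z ≠ 0 := by
    intro h0
    obtain ⟨M', h1, h2, h3⟩ := exists_larger_of_augmenting_path (p.concat huz) M hM hdeg hp'
      hodd' halt' hv (by omega)
    exact absurd (hmax M' h1 h2) (by omega)
  obtain ⟨e, heM, hze⟩ := Set.nonempty_of_ncard_ne_zero hz1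
  obtain ⟨w, rfl⟩ := Sym2.mem_iff_exists.1 hze
  have hzw : G.Adj z w := hM heM
  refine ⟨w, ?_, Sym2.eq_swap ▸ heM⟩
  by_cases hwp : w ∈ p.support
  · have halt_w := isAlternating_takeUntil halt hwp
    rcases Nat.even_or_odd (p.takeUntil w hwp).length with he | ho
    · exact ⟨_, hp.takeUntil hwp, he, halt_w⟩
    · exact absurd (mem_evenReach_of_odd (hp.takeUntil hwp) ho halt_w hzw.symm
        (Sym2.eq_swap ▸ heM) (fun h => hzp (p.support_takeUntil_subset_support hwp h))) hz
  · refine mem_evenReach_of_odd hp' hodd' halt' hzw heM ?_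
    simp [Walk.support_concat, hwp, hzw.ne']

end EvenReach

/-- If every vertex of `N` is joined by an edge of the 2-matching `M` to `Q`, then
`|N| ≤ 2|Q|`. -/
theorem ncard_le_two_mul_of_joined {V : Type*} [Finite V] {M : Set (Sym2 V)}
    (hdeg : ∀ x, degIn M x ≤ 2) {N Q : Set V} (h : ∀ z ∈ N, ∃ u ∈ Q, s(u, z) ∈ M) :
    N.ncard ≤ 2 * Q.ncard := by
  classical
  have hnbr : ∀ u, {z | s(u, z) ∈ M}.ncard ≤ 2 := fun u =>
    (Set.ncard_le_ncard_of_injOn (t := {e ∈ M | u ∈ e}) (fun z => s(u, z))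
      (fun z hz => ⟨hz, Sym2.mem_mk_left _ _⟩) (fun a _ b _ hab => Sym2.congr_right.1 hab)
      (Set.toFinite _)).trans (hdeg u)
  have hQ := Set.toFinite Q
  calc N.ncard ≤ (⋃ u ∈ hQ.toFinset, {z | s(u, z) ∈ M}).ncard :=
        Set.ncard_le_ncard (fun z hz => by simpa using h z hz) (Set.toFinite _)
    _ ≤ ∑ u ∈ hQ.toFinset, {z | s(u, z) ∈ M}.ncard := Finset.set_ncard_biUnion_le _ _
    _ ≤ ∑ _u ∈ hQ.toFinset, 2 := Finset.sum_le_sum fun u _ => hnbr u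
    _ = 2 * Q.ncard := by
      rw [Finset.sum_const, smul_eq_mul, mul_comm, Set.ncard_eq_toFinset_card Q hQ]

/-- let `M` be a maximum 2-matching, `v` a vertex with `deg_M(v) ≤ 1`
and `Q` the set of vertices reachable from `v` by an `M`-alternating path of even
length. Then every external neighbor of `Q` is joined to `Q` by an `M`-edge, and
`|N(Q)| ≤ 2|Q|`. -/
theorem stmt8 {V : Type*} [Fintype V] (G : SimpleGraph V) (M : Set (Sym2 V))
    (hM : M ⊆ G.edgeSet) (hdeg : ∀ v, degIn M v ≤ 2)
    (hmax : ∀ M' : Set (Sym2 V), M' ⊆ G.edgeSet → (∀ v, degIn M' v ≤ 2) →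
      M'.ncard ≤ M.ncard)
    (v : V) (hv : degIn M v ≤ 1) :
    let Q : Set V := {u | ∃ p : G.Walk v u, p.IsPath ∧ Even p.length ∧
      ∀ (j : ℕ) (h : j < p.edges.length),
        (Even j → p.edges.get ⟨j, h⟩ ∉ M) ∧ (Odd j → p.edges.get ⟨j, h⟩ ∈ M)}
    (∀ z ∈ {z | z ∉ Q ∧ ∃ u ∈ Q, G.Adj u z}, ∃ u ∈ Q, s(u, z) ∈ M) ∧
    {z | z ∉ Q ∧ ∃ u ∈ Q, G.Adj u z}.ncard ≤ 2 * Q.ncard := by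
  intro Q
  have hjoin : ∀ z ∈ {z | z ∉ Q ∧ ∃ u ∈ Q, G.Adj u z}, ∃ u ∈ Q, s(u, z) ∈ M := by
    rintro z ⟨hz, u, hu, huz⟩
    exact exists_mem_evenReach_of_adj hM hdeg hmax hv hz hu huz
  exact ⟨hjoin, ncard_le_two_mul_of_joined hdeg hjoin⟩
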